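/- arXiv:1510.08537 — 4 statements merged into one kernel-verified Lean document; each statement's English description precedes it below -/
import Mathlib

section
/- Let n ≥ 1 and let η₀(ξ) = |ξ|²/(1+|ξ|²)² for ξ ∈ ℝⁿ. Let s, ϱ ∈ ℝ with s + ϱ > 0, let α ∈ [1, ∞), let r ∈ [1, 2], and let ℓ > n(1/r − 1/2) (with ℓ ≥ 0 allowed in the case r = 2). Then there exists a constant C > 0 such that for every family (f_q)_{q∈ℤ} of Schwartz functions on ℝⁿ with supp \hat{f_q} ⊆ A_q for every q, and for every t ≥ 0: ( Σ_{q∈ℤ} ( 2^{qs} ‖\hat{f_q}(·) e^{−η₀(·)t}‖_{L²(ℝⁿ)} )^α )^{1/α} ≤ C [ (1+t)^{−(s+ϱ)/2} · sup_{q∈ℤ} 2^{−qϱ}‖f_q‖_{L²(ℝⁿ)} + (1+t)^{−ℓ/2 + (n/2)(1/r − 1/2)} · ( Σ_{q∈ℤ} ( 2^{q(s+ℓ)}‖f_q‖_{L^r(ℝⁿ)} )^α )^{1/α} ], whenever both quantities on the right-hand side are finite. -/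
open MeasureTheory Real
open scoped FourierTransform ENNReal NNReal

noncomputable section

theorem exists_rpow_mul_exp_neg_mul_le {b c : ℝ} (hb : 0 ≤ b) (hc : 0 < c) :
    ∃ K : ℝ, 0 < K ∧ ∀ y : ℝ, 0 ≤ y → y ^ b * exp (-c * y) ≤ K := by
  rcases hb.eq_or_lt with rfl | hb
  · refine ⟨1, one_pos, fun y hy => ?_⟩
    have : -c * y ≤ 0 := by nlinarith
    simpa using this
  · refine ⟨(b / c) ^ b, by positivity, fun y hy => ?_⟩
    have h1 : y ≤ b / c * exp (c * y / b) := by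
      have := add_one_le_exp (c * y / b)
      calc y = b / c * (c * y / b) := by field_simp
        _ ≤ _ := by gcongr; linarith
    calc y ^ b * exp (-c * y) ≤ (b / c * exp (c * y / b)) ^ b * exp (-c * y) := by gcongr
      _ = (b / c) ^ b * (exp (c * y) * exp (-c * y)) := by
        rw [mul_rpow (by positivity) (by positivity), ← exp_mul, mul_assoc]
        rw [div_mul_cancel₀ _ hb.ne']
      _ = _ := by rw [← exp_add]; simp

theorem summable_pow_natAbs {x : ℝ} (h0 : 0 ≤ x) (h1 : x < 1) :
    Summable fun k : ℤ => x ^ k.natAbs :=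
  Summable.of_nat_of_neg (by simpa using summable_geometric_of_lt_one h0 h1)
    (by simpa using summable_geometric_of_lt_one h0 h1)

theorem exists_tsum_zpow_rpow_mul_exp_le {b c : ℝ} (hb : 0 < b) (hc : 0 < c) :
    ∃ K : ℝ≥0, ∀ T : ℝ, 0 < T →
      ∑' q : ℤ, ENNReal.ofReal (((4 : ℝ) ^ q * T) ^ b * exp (-c * (4 ^ q * T))) ≤ K := by
  obtain ⟨K, hK, h⟩ := exists_rpow_mul_exp_neg_mul_le (add_nonneg hb.le hb.le) hc
  set x : ℝ := (4 : ℝ) ^ (-b) with hx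
  have hx0 : 0 < x := by positivity
  have hx1 : x < 1 := rpow_lt_one_of_one_lt_of_neg (by norm_num) (by linarith)
  set M : ℝ := max K 1 * 4 ^ b
  have hM : 0 < M := by positivity
  have hs : Summable fun k : ℤ => M * x ^ k.natAbs := (summable_pow_natAbs hx0.le hx1).mul_left M
  refine ⟨(∑' k : ℤ, M * x ^ k.natAbs).toNNReal, fun T hT => ?_⟩
  obtain ⟨m, hm1, hm2⟩ := exists_mem_Ico_zpow hT (by norm_num : (1 : ℝ) < 4)
  have key : ∀ q : ℤ, ((4 : ℝ) ^ q * T) ^ b * exp (-c * (4 ^ q * T))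
      ≤ M * x ^ (q + m).natAbs := by
    intro q
    set k := q + m with hk
    set y : ℝ := 4 ^ q * T with hy
    have hy0 : 0 < y := by positivity
    have hy1 : (4 : ℝ) ^ k ≤ y := by
      rw [hk, hy, zpow_add₀ (by norm_num)]; gcongr
    have hy2 : y ≤ (4 : ℝ) ^ (k + 1) := by
      rw [hk, hy, add_assoc, zpow_add₀ (by norm_num)]; gcongr
    rcases le_total 0 k with hk0 | hk0
    · have e1 : x ^ k.natAbs = ((4 : ℝ) ^ k) ^ (-b) := by
        lift k to ℕ using hk0 with j
        rw [hx, Int.natAbs_natCast, zpow_natCast, ← rpow_natCast, ← rpow_mul (by norm_num),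
          ← rpow_natCast, ← rpow_mul (by norm_num), mul_comm]
      have e2 : y ^ b * exp (-c * y) ≤ K * y ^ (-b) := by
        have := h y hy0.le
        rw [rpow_add hy0] at this
        rw [rpow_neg hy0.le, ← div_eq_mul_inv, le_div_iff₀ (by positivity)]
        linarith
      calc _ ≤ K * y ^ (-b) := e2
        _ ≤ K * ((4 : ℝ) ^ k) ^ (-b) := by
          exact mul_le_mul_of_nonneg_left
            (rpow_le_rpow_of_nonpos (by positivity) hy1 (by linarith)) hK.le
        _ ≤ M * x ^ k.natAbs := by
          rw [e1]
          gcongr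
          have : (1 : ℝ) ≤ 4 ^ b := one_le_rpow (by norm_num) hb.le
          have : K ≤ max K 1 := le_max_left _ _
          nlinarith
    · have e1 : x ^ k.natAbs = ((4 : ℝ) ^ k) ^ b := by
        obtain ⟨j, hj⟩ := Int.exists_eq_neg_ofNat hk0
        rw [hx, hj, Int.natAbs_neg, Int.natAbs_natCast, ← rpow_intCast, ← rpow_mul (by norm_num),
          ← rpow_natCast, ← rpow_mul (by norm_num)]
        push_cast
        ring_nf
      calc y ^ b * exp (-c * y) ≤ y ^ b * 1 := by
            gcongr
            exact exp_le_one_iff.2 (by nlinarith)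
        _ ≤ ((4 : ℝ) ^ (k + 1)) ^ b * 1 := by gcongr
        _ = 1 * 4 ^ b * ((4 : ℝ) ^ k) ^ b := by
            rw [zpow_add_one₀ (by norm_num), mul_rpow (by positivity) (by norm_num)]; ring
        _ ≤ M * x ^ k.natAbs := by
            rw [e1]
            gcongr
            exact mul_le_mul_of_nonneg_right (le_max_right _ _) (by positivity)
  calc _ ≤ ∑' q : ℤ, ENNReal.ofReal (M * x ^ (q + m).natAbs) :=
        ENNReal.tsum_le_tsum fun q => ENNReal.ofReal_le_ofReal (key q)
    _ = ∑' k : ℤ, ENNReal.ofReal (M * x ^ k.natAbs) :=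
        (Equiv.addRight m).tsum_eq fun k : ℤ => ENNReal.ofReal (M * x ^ k.natAbs)
    _ = _ := (ENNReal.ofReal_tsum_of_nonneg (fun k => by positivity) hs).symm

theorem zpow_le_regularity_loss_rate {E : Type*} [NormedAddCommGroup E] {ξ : E} {q : ℤ}
    (h1 : (3 / 4 : ℝ) * 2 ^ q ≤ ‖ξ‖) (h2 : ‖ξ‖ ≤ (8 / 3 : ℝ) * 2 ^ q) :
    (q ≤ 0 → 1 / 128 * (4 : ℝ) ^ q ≤ ‖ξ‖ ^ 2 / (1 + ‖ξ‖ ^ 2) ^ 2) ∧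
    (0 < q → 1 / 128 * (4 : ℝ) ^ (-q) ≤ ‖ξ‖ ^ 2 / (1 + ‖ξ‖ ^ 2) ^ 2) := by
  have h4 : (4 : ℝ) ^ q = (2 ^ q) ^ 2 := by
    rw [← zpow_natCast, ← zpow_mul, mul_comm, zpow_mul]; norm_num
  rw [zpow_neg, h4]
  have hz : (0 : ℝ) < 2 ^ q := by positivity
  set z : ℝ := 2 ^ q with hzdef
  set u := ‖ξ‖
  have hu : 0 < u := by linarith
  constructor
  · intro hq
    have hz1 : z ≤ 1 := zpow_le_one_of_nonpos₀ (by norm_num) hq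
    rw [le_div_iff₀ (by positivity)]
    have a1 : 1 + u ^ 2 ≤ 73 / 9 := by nlinarith
    have a2 : (1 + u ^ 2) ^ 2 ≤ (73 / 9) ^ 2 := by gcongr
    have a3 : (3 / 4 * z) ^ 2 ≤ u ^ 2 := by gcongr
    nlinarith [mul_le_mul_of_nonneg_left a2 (sq_nonneg z)]
  · intro hq
    have hz1 : 2 ≤ z := by
      have := zpow_le_zpow_right₀ (by norm_num : (1 : ℝ) ≤ 2) (show (1 : ℤ) ≤ q by omega)
      simpa using this
    have a1 : 1 + u ^ 2 ≤ 2 * u ^ 2 := by nlinarith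
    have a2 : (1 + u ^ 2) ^ 2 ≤ (2 * u ^ 2) ^ 2 := by gcongr
    have a3 : u ^ 2 ≤ (8 / 3 * z) ^ 2 := by gcongr
    rw [le_div_iff₀ (by positivity), mul_assoc, mul_comm, ← div_eq_mul_one_div,
      inv_mul_eq_div, div_div, div_le_iff₀ (by positivity)]
    nlinarith [mul_le_mul_of_nonneg_left a3 (sq_nonneg u)]

theorem eLpNorm_two_sq {E : Type*} [MeasurableSpace E] {μ : Measure E} (f : E → ℂ) :
    eLpNorm f 2 μ ^ (2 : ℝ) = ∫⁻ x, ‖f x‖ₑ ^ (2 : ℝ) ∂μ := by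
  rw [eLpNorm_eq_lintegral_rpow_enorm_toReal two_ne_zero ENNReal.ofNat_ne_top, ← ENNReal.rpow_mul]
  simp

section Bernstein

variable {V : Type*} [NormedAddCommGroup V] [InnerProductSpace ℝ V] [FiniteDimensional ℝ V]
  [MeasurableSpace V] [BorelSpace V]

theorem eLpNorm_fourier_two (f : SchwartzMap V ℂ) :
    eLpNorm (𝓕 ⇑f) 2 volume = eLpNorm ⇑f 2 volume := by
  have h := SchwartzMap.norm_fourier_toL2_eq f
  rw [SchwartzMap.norm_toLp, SchwartzMap.norm_toLp,
    ENNReal.toReal_eq_toReal_iff' ((𝓕 f).memLp 2 volume).2.ne (f.memLp 2 volume).2.ne,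
    SchwartzMap.fourier_coe] at h
  exact h

theorem enorm_apply_le_eLpNorm_fourier_one (f : SchwartzMap V ℂ) (x : V) :
    ‖f x‖ₑ ≤ eLpNorm (𝓕 ⇑f) 1 volume := by
  let F : SchwartzMap V ℂ := 𝓕 f
  have h := SchwartzMap.norm_fourier_apply_le_toLp_one F (-x)
  have h2 : 𝓕 F (-x) = f x := by
    have h3 : 𝓕⁻ F x = f x := by rw [FourierTransform.fourierInv_fourier_eq]
    rw [← h3, SchwartzMap.fourierInv_apply_eq]
    rfl
  rw [h2, SchwartzMap.norm_toLp] at h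
  have h4 := ENNReal.ofReal_le_ofReal h
  rwa [ofReal_norm, ENNReal.ofReal_toReal (F.memLp 1 volume).2.ne] at h4

theorem enorm_apply_le_measure_rpow_mul_eLpNorm_two (f : SchwartzMap V ℂ) {B : Set V}
    (hB : Function.support (𝓕 ⇑f) ⊆ B) (x : V) :
    ‖f x‖ₑ ≤ volume B ^ (1 / 2 : ℝ) * eLpNorm ⇑f 2 volume := by
  refine (enorm_apply_le_eLpNorm_fourier_one f x).trans ?_
  rw [← eLpNorm_restrict_eq_of_support_subset hB]
  refine (eLpNorm_le_eLpNorm_mul_rpow_measure_univ (q := 2) (by norm_num) ?_).trans ?_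
  · rw [← SchwartzMap.fourier_coe]
    exact (𝓕 f).continuous.aestronglyMeasurable
  · rw [eLpNorm_restrict_eq_of_support_subset hB, eLpNorm_fourier_two, mul_comm]
    simp only [Measure.restrict_apply_univ]
    norm_num

theorem eLpNorm_two_le_measure_rpow_mul_eLpNorm (f : SchwartzMap V ℂ) {B : Set V}
    (hB : Function.support (𝓕 ⇑f) ⊆ B) {r : ℝ} (hr1 : 1 ≤ r) (hr2 : r ≤ 2) :
    eLpNorm ⇑f 2 volume ≤
      volume B ^ (1 / r - 1 / 2) * eLpNorm ⇑f (ENNReal.ofReal r) volume := by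
  have hr0 : 0 < r := by linarith
  set N := eLpNorm ⇑f 2 volume with hN
  have hNtop : N ≠ ⊤ := (f.memLp 2 volume).2.ne
  rcases eq_or_ne N 0 with h0 | h0
  · simp [h0]
  set R := eLpNorm ⇑f (ENNReal.ofReal r) volume with hR
  have hRr : R ^ r = ∫⁻ x, ‖f x‖ₑ ^ r := by
    rw [hR, eLpNorm_eq_lintegral_rpow_enorm_toReal (by simpa using hr0) ENNReal.ofReal_ne_top,
      ENNReal.toReal_ofReal hr0.le, ← ENNReal.rpow_mul, one_div_mul_cancel hr0.ne',
      ENNReal.rpow_one]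
  set M := volume B ^ (1 / 2 : ℝ) * N
  have h1 : N ^ (2 : ℝ) ≤ M ^ (2 - r) * R ^ r := by
    rw [hRr, hN, eLpNorm_two_sq, ← lintegral_const_mul _ (by fun_prop)]
    refine lintegral_mono fun x => ?_
    calc ‖f x‖ₑ ^ (2 : ℝ) = ‖f x‖ₑ ^ (2 - r) * ‖f x‖ₑ ^ r := by
          rw [← ENNReal.rpow_add_of_nonneg _ _ (by linarith) hr0.le]; norm_num
      _ ≤ M ^ (2 - r) * ‖f x‖ₑ ^ r := by
          refine mul_le_mul_left (ENNReal.rpow_le_rpow ?_ (by linarith)) _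
          exact enorm_apply_le_measure_rpow_mul_eLpNorm_two f hB x
  have h2 : N ^ (2 - r) * N ^ r ≤ N ^ (2 - r) * (volume B ^ ((2 - r) / 2) * R ^ r) := by
    rw [← ENNReal.rpow_add_of_nonneg _ _ (by linarith) hr0.le]
    refine (le_of_eq (by norm_num)).trans (h1.trans (le_of_eq ?_))
    rw [ENNReal.mul_rpow_of_nonneg _ _ (by linarith), ← ENNReal.rpow_mul,
      show 1 / 2 * (2 - r) = (2 - r) / 2 by ring]
    ring
  have h3 : N ^ r ≤ volume B ^ ((2 - r) / 2) * R ^ r :=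
    (ENNReal.mul_le_mul_iff_right (ENNReal.rpow_pos (pos_iff_ne_zero.2 h0) hNtop).ne'
      (ENNReal.rpow_ne_top_of_nonneg (by linarith) hNtop)).1 h2
  have h4 := ENNReal.rpow_le_rpow h3 (one_div_nonneg.2 hr0.le)
  rw [ENNReal.mul_rpow_of_nonneg _ _ (by positivity), ← ENNReal.rpow_mul, ← ENNReal.rpow_mul,
    ← ENNReal.rpow_mul, mul_one_div_cancel hr0.ne', ENNReal.rpow_one, ENNReal.rpow_one] at h4
  convert h4 using 3
  field_simp

theorem exists_eLpNorm_two_le_of_support_fourier_subset_closedBall {r : ℝ} (hr1 : 1 ≤ r)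
    (hr2 : r ≤ 2) (a : ℝ) (ha : 0 ≤ a) :
    ∃ D : ℝ≥0, ∀ (q : ℤ) (f : SchwartzMap V ℂ),
      Function.support (𝓕 ⇑f) ⊆ Metric.closedBall 0 (a * 2 ^ q) →
      eLpNorm ⇑f 2 volume ≤
        D * ((2 : ℝ≥0∞) ^ ((q : ℝ) * (Module.finrank ℝ V * (1 / r - 1 / 2))) *
          eLpNorm ⇑f (ENNReal.ofReal r) volume) := by
  have hd : 0 ≤ 1 / r - 1 / 2 := by
    rw [sub_nonneg]; exact one_div_le_one_div_of_le (by linarith) hr2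
  set v : ℝ≥0∞ := ENNReal.ofReal (a ^ Module.finrank ℝ V) * volume (Metric.ball (0 : V) 1)
  have hv : v ^ (1 / r - 1 / 2) ≠ ⊤ := ENNReal.rpow_ne_top_of_nonneg hd
    (ENNReal.mul_ne_top ENNReal.ofReal_ne_top measure_ball_lt_top.ne)
  refine ⟨(v ^ (1 / r - 1 / 2)).toNNReal, fun q f hf => ?_⟩
  refine (eLpNorm_two_le_measure_rpow_mul_eLpNorm f hf hr1 hr2).trans (le_of_eq ?_)
  rw [ENNReal.coe_toNNReal hv, Measure.addHaar_closedBall _ _ (by positivity), mul_pow,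
    ENNReal.ofReal_mul (by positivity), mul_right_comm, ENNReal.mul_rpow_of_nonneg _ _ hd,
    mul_assoc]
  congr 2
  have : ENNReal.ofReal (((2 : ℝ) ^ q) ^ Module.finrank ℝ V)
      = (2 : ℝ≥0∞) ^ ((q : ℝ) * Module.finrank ℝ V) := by
    rw [← rpow_intCast, ← rpow_natCast, ← rpow_mul (by norm_num),
      ← ENNReal.ofReal_rpow_of_pos (by norm_num)]
    simp
  rw [this, ← ENNReal.rpow_mul, mul_assoc]

end Bernstein

theorem two_rpow_intCast_mul_eq_ofReal (q : ℤ) (x : ℝ) :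
    (2 : ℝ≥0∞) ^ ((q : ℝ) * x) = ENNReal.ofReal (((4 : ℝ) ^ q) ^ (x / 2)) := by
  rw [← rpow_intCast, ← rpow_mul (by norm_num), show (4 : ℝ) = 2 ^ (2 : ℝ) by norm_num,
    ← rpow_mul (by norm_num), ← ENNReal.ofReal_rpow_of_pos (by norm_num), ENNReal.ofReal_ofNat]
  congr 1
  ring

theorem rpow_mul_exp_neg_le {x t a c : ℝ} (hx : 0 < x) (hx1 : x ≤ 1) (hc : 0 < c) (ht : 0 ≤ t) :
    x ^ a * exp (-(c * x) * t) ≤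
      (1 + t) ^ (-a) * (exp c * ((x * (1 + t)) ^ a * exp (-c * (x * (1 + t))))) := by
  have hT : 0 < 1 + t := by linarith
  rw [mul_rpow hx.le hT.le, rpow_neg hT.le]
  have h : exp (-(c * x) * t) ≤ exp c * exp (-c * (x * (1 + t))) := by
    rw [← exp_add]
    gcongr
    nlinarith
  calc x ^ a * exp (-(c * x) * t) ≤ x ^ a * (exp c * exp (-c * (x * (1 + t)))) := by gcongr
    _ = _ := by field_simp

theorem eLpNorm_exp_smul_le {E : Type*} [NormedAddCommGroup E] [MeasurableSpace E]
    {μ : Measure E} (g : E → ℂ) {η : E → ℝ} {t m : ℝ} (ht : 0 ≤ t)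
    (h : ∀ ξ ∈ Function.support g, m ≤ η ξ) (p : ℝ≥0∞) :
    eLpNorm (fun ξ => exp (-(η ξ) * t) • g ξ) p μ ≤
      ENNReal.ofReal (exp (-m * t)) * eLpNorm g p μ := by
  refine eLpNorm_le_mul_eLpNorm_of_ae_le_mul (Filter.Eventually.of_forall fun ξ => ?_) p
  by_cases hξ : g ξ = 0
  · simp [hξ]
  · rw [norm_smul, norm_of_nonneg (exp_pos _).le]
    gcongr
    exact h ξ hξ


/-- Corollary 1.1 (frequency-block form): frequency-localization time-decay inequality
for the dissipative rate `η₀(ξ) = |ξ|²/(1+|ξ|²)²` of regularity-loss type. -/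
theorem freq_localization_time_decay_eta0
    (n : ℕ) (hn : 1 ≤ n) (s ϱ : ℝ) (hsϱ : 0 < s + ϱ)
    (α : ℝ) (hα : 1 ≤ α) (r : ℝ) (hr1 : 1 ≤ r) (hr2 : r ≤ 2)
    (ℓ : ℝ) (hℓ : (n : ℝ) * (1 / r - 1 / 2) < ℓ ∨ (r = 2 ∧ 0 ≤ ℓ)) :
    ∃ C : ℝ≥0, 0 < C ∧
      ∀ f : ℤ → SchwartzMap (EuclideanSpace ℝ (Fin n)) ℂ,
        (∀ q : ℤ, Function.support (𝓕 ⇑(f q)) ⊆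
          {ξ : EuclideanSpace ℝ (Fin n) | (3 / 4 : ℝ) * 2 ^ q ≤ ‖ξ‖ ∧ ‖ξ‖ ≤ (8 / 3 : ℝ) * 2 ^ q}) →
        (⨆ q : ℤ, (2 : ℝ≥0∞) ^ (-(q : ℝ) * ϱ) * eLpNorm (⇑(f q)) 2 volume) ≠ ⊤ →
        (∑' q : ℤ, ((2 : ℝ≥0∞) ^ ((q : ℝ) * (s + ℓ)) *
            eLpNorm (⇑(f q)) (ENNReal.ofReal r) volume) ^ α) ≠ ⊤ →
        ∀ t : ℝ, 0 ≤ t →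
          (∑' q : ℤ, ((2 : ℝ≥0∞) ^ ((q : ℝ) * s) *
              eLpNorm (fun ξ : EuclideanSpace ℝ (Fin n) =>
                Real.exp (-(‖ξ‖ ^ 2 / (1 + ‖ξ‖ ^ 2) ^ 2) * t) • 𝓕 (⇑(f q)) ξ) 2 volume) ^ α)
            ^ (1 / α)
          ≤ C * (ENNReal.ofReal (1 + t) ^ (-(s + ϱ) / 2) *
                  (⨆ q : ℤ, (2 : ℝ≥0∞) ^ (-(q : ℝ) * ϱ) * eLpNorm (⇑(f q)) 2 volume)
               + ENNReal.ofReal (1 + t) ^ (-ℓ / 2 + (n : ℝ) / 2 * (1 / r - 1 / 2)) *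
                  (∑' q : ℤ, ((2 : ℝ≥0∞) ^ ((q : ℝ) * (s + ℓ)) *
                    eLpNorm (⇑(f q)) (ENNReal.ofReal r) volume) ^ α) ^ (1 / α)) := by
  obtain ⟨D, hD⟩ := exists_eLpNorm_two_le_of_support_fourier_subset_closedBall
    (V := EuclideanSpace ℝ (Fin n)) hr1 hr2 (8 / 3) (by norm_num)
  set δ : ℝ := n * (1 / r - 1 / 2) with hδ
  have hδℓ : 0 ≤ (ℓ - δ) / 2 := by
    rcases hℓ with h | ⟨rfl, h⟩
    · linarith
    · have : δ = 0 := by simp [hδ]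
      linarith
  have hα0 : 0 < α := by linarith
  set a : ℝ := (s + ϱ) / 2 with ha
  have ha0 : 0 < a := by positivity
  set c : ℝ := 1 / 128 with hc
  have hc0 : 0 < c := by norm_num [hc]
  obtain ⟨K, hK⟩ := exists_tsum_zpow_rpow_mul_exp_le (mul_pos ha0 hα0) (mul_pos hc0 hα0)
  obtain ⟨L, hL0, hL⟩ := exists_rpow_mul_exp_neg_mul_le hδℓ hc0
  set e : ℝ≥0 := (exp c).toNNReal with he
  have hee : ENNReal.ofReal (exp c) = e := rfl
  set C₁ : ℝ≥0 := e * K ^ (1 / α)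
  set C₂ : ℝ≥0 := e * L.toNNReal * D
  refine ⟨C₁ + C₂ + 1, by positivity, fun f hf _ _ t ht => ?_⟩
  have hT : 0 < 1 + t := by linarith
  set S : ℝ≥0∞ := ⨆ q : ℤ, (2 : ℝ≥0∞) ^ (-(q : ℝ) * ϱ) * eLpNorm (⇑(f q)) 2 volume with hS
  set b : ℤ → ℝ≥0∞ := fun q => (2 : ℝ≥0∞) ^ ((q : ℝ) * (s + ℓ)) *
    eLpNorm (⇑(f q)) (ENNReal.ofReal r) volume with hb
  set w : ℤ → ℝ≥0∞ := fun q => (2 : ℝ≥0∞) ^ ((q : ℝ) * s) *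
    eLpNorm (fun ξ : EuclideanSpace ℝ (Fin n) =>
      Real.exp (-(‖ξ‖ ^ 2 / (1 + ‖ξ‖ ^ 2) ^ 2) * t) • 𝓕 (⇑(f q)) ξ) 2 volume with hw
  set g : ℤ → ℝ≥0∞ := fun q =>
    ENNReal.ofReal (((4 : ℝ) ^ q * (1 + t)) ^ a * exp (-c * (4 ^ q * (1 + t)))) with hg
  have low : ∀ q : ℤ, q ≤ 0 →
      w q ≤ ENNReal.ofReal (1 + t) ^ (-a) * (e * S) * g q := by
    intro q hq
    have h1 := eLpNorm_exp_smul_le (μ := volume) (𝓕 ⇑(f q))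
      (η := fun ξ => ‖ξ‖ ^ 2 / (1 + ‖ξ‖ ^ 2) ^ 2) ht
      (fun ξ hξ => (zpow_le_regularity_loss_rate (hf q hξ).1 (hf q hξ).2).1 hq) 2
    rw [eLpNorm_fourier_two] at h1
    have h2 : eLpNorm (⇑(f q)) 2 volume ≤ 2 ^ ((q : ℝ) * ϱ) * S := by
      have := le_iSup (fun q : ℤ => (2 : ℝ≥0∞) ^ (-(q : ℝ) * ϱ) * eLpNorm (⇑(f q)) 2 volume) q
      calc eLpNorm (⇑(f q)) 2 volume
          = 2 ^ ((q : ℝ) * ϱ) * (2 ^ (-(q : ℝ) * ϱ) * eLpNorm (⇑(f q)) 2 volume) := by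
            rw [← mul_assoc, ← ENNReal.rpow_add _ _ two_ne_zero ENNReal.ofNat_ne_top]
            simp
        _ ≤ _ := by gcongr
    have h3 := rpow_mul_exp_neg_le (a := a) (by positivity : (0 : ℝ) < 4 ^ q)
      (zpow_le_one_of_nonpos₀ (by norm_num) hq) hc0 ht
    calc w q ≤ 2 ^ ((q : ℝ) * s) * (ENNReal.ofReal (exp (-(c * 4 ^ q) * t)) *
          (2 ^ ((q : ℝ) * ϱ) * S)) := by
          simp only [hw]
          gcongr
          exact h1.trans (by gcongr)
      _ = ENNReal.ofReal (((4 : ℝ) ^ q) ^ a * exp (-(c * 4 ^ q) * t)) * S := by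
          rw [ENNReal.ofReal_mul (by positivity), ha, ← two_rpow_intCast_mul_eq_ofReal, mul_add,
            ENNReal.rpow_add _ _ two_ne_zero ENNReal.ofNat_ne_top]
          ring
      _ ≤ ENNReal.ofReal ((1 + t) ^ (-a) * (exp c *
          (((4 : ℝ) ^ q * (1 + t)) ^ a * exp (-c * (4 ^ q * (1 + t)))))) * S := by gcongr
      _ = _ := by
          rw [ENNReal.ofReal_mul (by positivity), ENNReal.ofReal_mul (by positivity), hee,
            ENNReal.ofReal_rpow_of_pos hT]
          ring
  have high : ∀ q : ℤ, 0 < q →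
      w q ≤ ENNReal.ofReal (1 + t) ^ (-((ℓ - δ) / 2)) * C₂ * b q := by
    intro q hq
    have h1 := eLpNorm_exp_smul_le (μ := volume) (𝓕 ⇑(f q))
      (η := fun ξ => ‖ξ‖ ^ 2 / (1 + ‖ξ‖ ^ 2) ^ 2) ht
      (fun ξ hξ => (zpow_le_regularity_loss_rate (hf q hξ).1 (hf q hξ).2).2 hq) 2
    rw [eLpNorm_fourier_two] at h1
    have h2 := hD q (f q) fun ξ hξ => by simpa using (hf q hξ).2
    rw [finrank_euclideanSpace_fin, ← hδ] at h2
    have h3 := rpow_mul_exp_neg_le (a := (ℓ - δ) / 2) (by positivity : (0 : ℝ) < 4 ^ (-q))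
      (zpow_le_one_of_nonpos₀ (by norm_num) (by omega)) hc0 ht
    have h4 := hL ((4 : ℝ) ^ (-q) * (1 + t)) (by positivity)
    calc w q ≤ 2 ^ ((q : ℝ) * s) * (ENNReal.ofReal (exp (-(c * 4 ^ (-q)) * t)) *
          (D * (2 ^ ((q : ℝ) * δ) * eLpNorm (⇑(f q)) (ENNReal.ofReal r) volume))) := by
          simp only [hw]
          gcongr
          exact h1.trans (by gcongr)
      _ = ENNReal.ofReal (((4 : ℝ) ^ (-q)) ^ ((ℓ - δ) / 2) * exp (-(c * 4 ^ (-q)) * t)) *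
          D * b q := by
          rw [ENNReal.ofReal_mul (by positivity), ← two_rpow_intCast_mul_eq_ofReal]
          have : (2 : ℝ≥0∞) ^ ((q : ℝ) * s) * 2 ^ ((q : ℝ) * δ) =
              2 ^ (((-q : ℤ) : ℝ) * (ℓ - δ)) * 2 ^ ((q : ℝ) * (s + ℓ)) := by
            rw [← ENNReal.rpow_add _ _ two_ne_zero ENNReal.ofNat_ne_top,
              ← ENNReal.rpow_add _ _ two_ne_zero ENNReal.ofNat_ne_top]
            congr 1
            push_cast
            ring
          simp only [hb]
          trans (2 ^ ((q : ℝ) * s) * 2 ^ ((q : ℝ) * δ)) * (ENNReal.ofReal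
            (exp (-(c * 4 ^ (-q)) * t)) * D * eLpNorm (⇑(f q)) (ENNReal.ofReal r) volume)
          · ring
          · rw [this]
            ring
      _ ≤ ENNReal.ofReal ((1 + t) ^ (-((ℓ - δ) / 2)) * (exp c * L)) * D * b q := by
          have h5 := h3.trans (mul_le_mul_of_nonneg_left
            (mul_le_mul_of_nonneg_left h4 (exp_pos c).le) (by positivity))
          exact mul_le_mul_left (mul_le_mul_left (ENNReal.ofReal_le_ofReal h5) _) _
      _ = _ := by
          rw [ENNReal.ofReal_mul (by positivity), ENNReal.ofReal_mul (by positivity), hee,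
            ENNReal.ofReal_rpow_of_pos hT]
          simp only [C₂, ENNReal.coe_mul, ENNReal.ofReal]
          ring
  set P : ℝ≥0∞ := ENNReal.ofReal (1 + t) ^ (-a) * (e * S)
  set Q : ℝ≥0∞ := ENNReal.ofReal (1 + t) ^ (-((ℓ - δ) / 2)) * C₂
  have hgα : ∀ q, g q ^ α = ENNReal.ofReal
      (((4 : ℝ) ^ q * (1 + t)) ^ (a * α) * exp (-(c * α) * (4 ^ q * (1 + t)))) := by
    intro q
    simp only [hg]
    rw [ENNReal.ofReal_rpow_of_nonneg (by positivity) hα0.le,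
      mul_rpow (by positivity) (by positivity), ← rpow_mul (by positivity), ← exp_mul]
    ring_nf
  have hwα : ∀ q, w q ^ α ≤ P ^ α * g q ^ α + Q ^ α * b q ^ α := by
    intro q
    rw [← ENNReal.mul_rpow_of_nonneg _ _ hα0.le, ← ENNReal.mul_rpow_of_nonneg _ _ hα0.le]
    rcases le_or_gt q 0 with hq | hq
    · exact (ENNReal.rpow_le_rpow (low q hq) hα0.le).trans le_self_add
    · exact (ENNReal.rpow_le_rpow (high q hq) hα0.le).trans le_add_self
  have hinv : ∀ x : ℝ≥0∞, (x ^ α) ^ (1 / α) = x := fun x => by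
    rw [← ENNReal.rpow_mul, mul_one_div_cancel hα0.ne', ENNReal.rpow_one]
  have h1α : 0 ≤ 1 / α := by positivity
  have e1 : -(s + ϱ) / 2 = -a := by rw [ha]; ring
  have e2 : -ℓ / 2 + (n : ℝ) / 2 * (1 / r - 1 / 2) = -((ℓ - δ) / 2) := by rw [hδ]; ring
  rw [e1, e2]
  calc (∑' q, w q ^ α) ^ (1 / α)
      ≤ (P ^ α * K + Q ^ α * ∑' q, b q ^ α) ^ (1 / α) := by
        refine ENNReal.rpow_le_rpow ?_ h1α
        refine (ENNReal.tsum_le_tsum hwα).trans ?_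
        rw [ENNReal.tsum_add, ENNReal.tsum_mul_left, ENNReal.tsum_mul_left]
        gcongr
        simp_rw [hgα]
        exact hK _ hT
    _ ≤ (P ^ α * K) ^ (1 / α) + (Q ^ α * ∑' q, b q ^ α) ^ (1 / α) :=
        ENNReal.rpow_add_le_add_rpow _ _ h1α (by rw [div_le_one hα0]; exact hα)
    _ = P * (K : ℝ≥0∞) ^ (1 / α) + Q * (∑' q, b q ^ α) ^ (1 / α) := by
        rw [ENNReal.mul_rpow_of_nonneg _ _ h1α, ENNReal.mul_rpow_of_nonneg _ _ h1α, hinv, hinv]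
    _ = C₁ * (ENNReal.ofReal (1 + t) ^ (-a) * S) +
        C₂ * (ENNReal.ofReal (1 + t) ^ (-((ℓ - δ) / 2)) * (∑' q, b q ^ α) ^ (1 / α)) := by
        simp only [P, Q, C₁, ENNReal.coe_mul, ENNReal.coe_rpow_of_nonneg _ h1α]
        ring
    _ ≤ _ := by
        rw [mul_add]
        gcongr
        · exact (le_self_add).trans le_self_add
        · exact le_add_self.trans le_self_add
end
end

section
/- Let n ≥ 1, σ > 0, c > 0, R > 0, and let m ∈ (2, ∞) and ℓ > n/m. Then there exists a constant C > 0 such that for every t ≥ 0: ( ∫_{{ξ ∈ ℝⁿ : |ξ| ≥ R}} |ξ|^{−ℓm} e^{−m c t |ξ|^{−σ}} dξ )^{1/m} ≤ C (1+t)^{−(ℓ − n/m)/σ}. -/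
open MeasureTheory Real

noncomputable section

/-- A power is dominated by an exponential, with an explicit constant. -/
lemma rpow_le_mul_exp {a q y : ℝ} (ha : 0 < a) (hq : 0 < q) (hy : 0 ≤ y) :
    y ^ q ≤ (q / a) ^ q * exp (a * y) := by
  have h : y ≤ q / a * exp (a * y / q) := by
    have h1 : a * y / q ≤ exp (a * y / q) := by linarith [add_one_le_exp (a * y / q)]
    calc y = q / a * (a * y / q) := by field_simp
      _ ≤ _ := by gcongr
  calc y ^ q ≤ (q / a * exp (a * y / q)) ^ q := by gcongr
    _ = _ := by
      rw [mul_rpow (by positivity) (by positivity), ← exp_mul, div_mul_cancel₀ _ hq.ne']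

/-- The profile `r ↦ r ^ (-p) * exp (-a * r ^ (-σ))` is dominated by `(1 + r) ^ (-p)`. -/
lemma exists_rpow_neg_mul_exp_le {a p σ : ℝ} (ha : 0 < a) (hp : 0 < p) (hσ : 0 < σ) :
    ∃ K : ℝ, ∀ r : ℝ, 0 ≤ r →
      r ^ (-p) * exp (-a * r ^ (-σ)) ≤ K * (1 + r) ^ (-p) := by
  refine ⟨2 ^ p * ((p / σ / a) ^ (p / σ) + 1), fun r hr ↦ ?_⟩
  rcases hr.eq_or_lt with rfl | hr
  · rw [zero_rpow (neg_ne_zero.2 hp.ne'), zero_mul]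
    positivity
  have hK : 0 ≤ (p / σ / a) ^ (p / σ) := by positivity
  rcases le_total r 1 with h1 | h1
  · have h := rpow_le_mul_exp ha (div_pos hp hσ) (rpow_nonneg hr.le (-σ))
    rw [← rpow_mul hr.le, show -σ * (p / σ) = -p by field_simp] at h
    have h2 : (2 : ℝ) ^ (-p) ≤ (1 + r) ^ (-p) :=
      rpow_le_rpow_of_nonpos (by positivity) (by linarith) (by linarith)
    calc r ^ (-p) * exp (-a * r ^ (-σ))
        ≤ (p / σ / a) ^ (p / σ) * exp (a * r ^ (-σ)) * exp (-a * r ^ (-σ)) := by gcongr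
      _ = (p / σ / a) ^ (p / σ) := by
        rw [mul_assoc, ← exp_add, neg_mul, add_neg_cancel, exp_zero, mul_one]
      _ ≤ (p / σ / a) ^ (p / σ) + 1 := by linarith
      _ = 2 ^ p * ((p / σ / a) ^ (p / σ) + 1) * 2 ^ (-p) := by
        rw [rpow_neg zero_le_two]
        field_simp
      _ ≤ _ := by gcongr
  · have h2 : (2 * r) ^ (-p) ≤ (1 + r) ^ (-p) :=
      rpow_le_rpow_of_nonpos (by positivity) (by linarith) (by linarith)
    have h3 : exp (-a * r ^ (-σ)) ≤ 1 := by
      rw [exp_le_one_iff, neg_mul, neg_nonpos]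
      positivity
    calc r ^ (-p) * exp (-a * r ^ (-σ)) ≤ 1 * r ^ (-p) := by
          rw [mul_comm]
          gcongr
      _ ≤ ((p / σ / a) ^ (p / σ) + 1) * r ^ (-p) := by
          gcongr
          linarith
      _ = 2 ^ p * ((p / σ / a) ^ (p / σ) + 1) * (2 * r) ^ (-p) := by
          rw [mul_rpow zero_le_two hr.le, rpow_neg zero_le_two]
          field_simp
      _ ≤ _ := by gcongr

section

variable {E : Type*} [NormedAddCommGroup E] [NormedSpace ℝ E] [FiniteDimensional ℝ E]
  [MeasurableSpace E] [BorelSpace E] (μ : Measure E) [μ.IsAddHaarMeasure]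

open Module

lemma integrable_norm_rpow_neg_mul_exp {a p σ : ℝ} (ha : 0 < a) (hp : (finrank ℝ E : ℝ) < p)
    (hσ : 0 < σ) :
    Integrable (fun x : E ↦ ‖x‖ ^ (-p) * exp (-a * ‖x‖ ^ (-σ))) μ := by
  obtain ⟨K, hK⟩ := exists_rpow_neg_mul_exp_le ha (hp.trans_le' (Nat.cast_nonneg _)) hσ
  refine ((integrable_one_add_norm hp).const_mul K).mono'
    (Measurable.aestronglyMeasurable (by fun_prop)) (.of_forall fun x ↦ ?_)
  rw [norm_of_nonneg (by positivity)]
  exact hK _ (norm_nonneg x)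

/-- Over an exterior region, the scaling `x = (1 + t) ^ (1 / σ) • y` bounds the integral of the
kernel by a multiple of `(1 + t) ^ ((finrank ℝ E - p) / σ)`. -/
lemma setIntegral_norm_rpow_neg_mul_exp_le {a p σ R t : ℝ} (ha : 0 < a)
    (hp : (finrank ℝ E : ℝ) < p) (hσ : 0 < σ) (hR : 0 < R) (ht : 0 ≤ t) :
    ∫ x in {x : E | R ≤ ‖x‖}, ‖x‖ ^ (-p) * exp (-(a * t) * ‖x‖ ^ (-σ)) ∂μ ≤
      exp (a * R ^ (-σ)) * (∫ x, ‖x‖ ^ (-p) * exp (-a * ‖x‖ ^ (-σ)) ∂μ) *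
        (1 + t) ^ ((finrank ℝ E - p) / σ) := by
  set g : E → ℝ := fun x ↦ ‖x‖ ^ (-p) * exp (-a * ‖x‖ ^ (-σ)) with hg
  have hgi : Integrable g μ := integrable_norm_rpow_neg_mul_exp μ ha hp hσ
  have hg0 (x : E) : 0 ≤ g x := by positivity
  have ht1 : 0 < 1 + t := by linarith
  set s : ℝ := (1 + t) ^ (1 / σ) with hs
  have hs0 : 0 < s := rpow_pos_of_pos ht1 _
  have hsσ : s ^ σ = 1 + t := by
    rw [hs, ← rpow_mul ht1.le, one_div_mul_cancel hσ.ne', rpow_one]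
  set A : ℝ := exp (a * R ^ (-σ)) * s ^ (-p) with hA
  have hA0 : 0 ≤ A := by positivity
  have hGi : Integrable (fun x : E ↦ A * g (s⁻¹ • x)) μ :=
    (hgi.comp_smul (inv_ne_zero hs0.ne')).const_mul A
  have hscale (x : E) :
      s ^ (-p) * g (s⁻¹ • x) = ‖x‖ ^ (-p) * exp (-(a * (1 + t)) * ‖x‖ ^ (-σ)) := by
    have hn : ‖s⁻¹ • x‖ = s⁻¹ * ‖x‖ := by rw [norm_smul, norm_of_nonneg (by positivity)]
    have hinv (q : ℝ) : s⁻¹ ^ (-q) = s ^ q := by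
      rw [inv_rpow hs0.le, rpow_neg hs0.le, inv_inv]
    simp only [hg, hn, mul_rpow (inv_nonneg.2 hs0.le) (norm_nonneg x), hinv, hsσ]
    rw [← mul_assoc, ← mul_assoc, ← rpow_add hs0, neg_add_cancel, rpow_zero, one_mul]
    congr 2
    ring
  have hbound (x : E) (hx : R ≤ ‖x‖) :
      ‖x‖ ^ (-p) * exp (-(a * t) * ‖x‖ ^ (-σ)) ≤ A * g (s⁻¹ • x) := by
    have hxR : ‖x‖ ^ (-σ) ≤ R ^ (-σ) := rpow_le_rpow_of_nonpos hR hx (by linarith)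
    rw [hA, mul_assoc, hscale, mul_left_comm, ← exp_add]
    gcongr
    nlinarith
  have hmeas : MeasurableSet {x : E | R ≤ ‖x‖} := measurableSet_le measurable_const measurable_norm
  calc ∫ x in {x : E | R ≤ ‖x‖}, ‖x‖ ^ (-p) * exp (-(a * t) * ‖x‖ ^ (-σ)) ∂μ
      ≤ ∫ x in {x : E | R ≤ ‖x‖}, A * g (s⁻¹ • x) ∂μ :=
        integral_mono_of_nonneg (.of_forall fun x ↦ by positivity) hGi.integrableOn
          ((ae_restrict_iff' hmeas).2 (.of_forall hbound))
    _ ≤ ∫ x, A * g (s⁻¹ • x) ∂μ :=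
        setIntegral_le_integral hGi (.of_forall fun x ↦ mul_nonneg hA0 (hg0 _))
    _ = A * (s ^ finrank ℝ E * ∫ x, g x ∂μ) := by
        rw [integral_const_mul, Measure.integral_comp_inv_smul_of_nonneg μ g hs0.le, smul_eq_mul]
    _ = exp (a * R ^ (-σ)) * (∫ x, g x ∂μ) * (s ^ (-p) * s ^ (finrank ℝ E : ℝ)) := by
        rw [rpow_natCast, hA]
        ring
    _ = _ := by
        rw [← rpow_add hs0, hs, ← rpow_mul ht1.le]
        congr 2
        ring

end

/-- Estimate (R-E21): the `L^m` norm over the exterior region `{|ξ| ≥ R}` of the kernel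
`ξ ↦ e^{-ct|ξ|^{-σ}}/|ξ|^ℓ` decays at the algebraic rate `(1+t)^{-(ℓ - n/m)/σ}`. -/
theorem high_freq_kernel_Lm_decay
    (n : ℕ) (hn : 1 ≤ n) (σ c R : ℝ) (hσ : 0 < σ) (hc : 0 < c) (hR : 0 < R)
    (m : ℝ) (hm : 2 < m) (ℓ : ℝ) (hℓ : (n : ℝ) / m < ℓ) :
    ∃ C : ℝ, 0 < C ∧ ∀ t : ℝ, 0 ≤ t →
      (∫ ξ in {ξ : EuclideanSpace ℝ (Fin n) | R ≤ ‖ξ‖},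
          ‖ξ‖ ^ (-(ℓ * m)) * Real.exp (-(m * c * t) * ‖ξ‖ ^ (-σ))) ^ (1 / m)
        ≤ C * (1 + t) ^ (-(ℓ - (n : ℝ) / m) / σ) := by
  have hm0 : 0 < m := by linarith
  set B : ℝ := exp (m * c * R ^ (-σ)) * ∫ ξ : EuclideanSpace ℝ (Fin n),
    ‖ξ‖ ^ (-(ℓ * m)) * exp (-(m * c) * ‖ξ‖ ^ (-σ)) with hB
  have hB0 : 0 ≤ B := mul_nonneg (exp_pos _).le (integral_nonneg fun ξ ↦ by positivity)
  refine ⟨(B + 1) ^ (1 / m), by positivity, fun t ht ↦ ?_⟩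
  have h := setIntegral_norm_rpow_neg_mul_exp_le
    (volume : Measure (EuclideanSpace ℝ (Fin n))) (mul_pos hm0 hc) (p := ℓ * m)
    (by rwa [finrank_euclideanSpace_fin, ← div_lt_iff₀ hm0]) hσ hR ht
  rw [finrank_euclideanSpace_fin, ← hB] at h
  calc _ ≤ ((B + 1) * (1 + t) ^ ((n - ℓ * m) / σ)) ^ (1 / m) := by
        refine rpow_le_rpow (integral_nonneg fun ξ ↦ by positivity) (h.trans ?_) (by positivity)
        gcongr
        linarith
    _ = _ := by
        rw [mul_rpow (by positivity) (by positivity), ← rpow_mul (by positivity)]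
        congr 2
        field_simp
        ring
end
end

section
/- Let n ≥ 1, σ > 0, c > 0, R₀ > 0, let r ∈ [1, 2] and let ℓ > n(1/r − 1/2) (with ℓ ≥ 0 allowed in the case r = 2). Then there exists a constant C > 0 such that for every q ∈ ℤ with 2^q ≥ R₀, every Schwartz function f on ℝⁿ with supp \hat f ⊆ A_q, and every t ≥ 0: ‖\hat f(·) e^{−c t |·|^{−σ}}‖_{L²(ℝⁿ)} ≤ C · 2^{qℓ} (1+t)^{−ℓ/σ + (n/σ)(1/r − 1/2)} ‖f‖_{L^r(ℝⁿ)}. -/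
open MeasureTheory Real
open scoped FourierTransform ENNReal NNReal

noncomputable section

/-- Interpolation of `L²` between `L^r` and `L^∞`. -/
theorem eLpNorm_two_sq_le_of_enorm_le {α E : Type*} [MeasurableSpace α] [NormedAddCommGroup E]
    {μ : Measure α} {f : α → E} (hf : AEStronglyMeasurable f μ) {M : ℝ≥0∞}
    (hM : ∀ x, ‖f x‖ₑ ≤ M) {r : ℝ} (hr0 : 0 < r) (hr2 : r ≤ 2) :
    eLpNorm f 2 μ ^ (2 : ℝ) ≤ M ^ (2 - r) * eLpNorm f (ENNReal.ofReal r) μ ^ r := by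
  have hr : ENNReal.ofReal r ≠ 0 := by simpa using hr0
  rw [eLpNorm_eq_lintegral_rpow_enorm_toReal two_ne_zero ENNReal.ofNat_ne_top,
    eLpNorm_eq_lintegral_rpow_enorm_toReal hr ENNReal.ofReal_ne_top,
    ENNReal.toReal_ofReal hr0.le, ENNReal.toReal_ofNat, ← ENNReal.rpow_mul, ← ENNReal.rpow_mul,
    one_div_mul_cancel two_ne_zero, one_div_mul_cancel hr0.ne', ENNReal.rpow_one,
    ENNReal.rpow_one, ← lintegral_const_mul'' _ (hf.enorm.pow_const r)]
  refine lintegral_mono fun x => ?_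
  calc ‖f x‖ₑ ^ (2 : ℝ) = ‖f x‖ₑ ^ (2 - r) * ‖f x‖ₑ ^ r := by
        rw [← ENNReal.rpow_add_of_nonneg _ _ (by linarith) hr0.le, sub_add_cancel]
    _ ≤ M ^ (2 - r) * ‖f x‖ₑ ^ r := by
        gcongr
        exact hM x

section Bernstein

variable {V H : Type*} [NormedAddCommGroup V] [InnerProductSpace ℝ V] [FiniteDimensional ℝ V]
  [MeasurableSpace V] [BorelSpace V] [NormedAddCommGroup H] [InnerProductSpace ℂ H]
  [CompleteSpace H]

theorem SchwartzMap.eLpNorm_two_fourier (f : SchwartzMap V H) :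
    eLpNorm (𝓕 ⇑f) 2 volume = eLpNorm (⇑f) 2 volume := by
  have h := SchwartzMap.norm_fourier_toL2_eq f
  rw [SchwartzMap.norm_toLp, SchwartzMap.norm_toLp,
    ENNReal.toReal_eq_toReal_iff' ((𝓕 f).memLp 2 volume).eLpNorm_ne_top
      (f.memLp 2 volume).eLpNorm_ne_top] at h
  exact h

theorem SchwartzMap.enorm_apply_le_eLpNorm_fourier (f : SchwartzMap V H) (x : V) :
    ‖f x‖ₑ ≤ eLpNorm (𝓕 ⇑f) 1 volume := by
  have h : f x = ∫ ξ, 𝐞 (inner ℝ ξ x) • 𝓕 (⇑f) ξ := by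
    rw [← Real.fourierInv_eq, f.continuous.fourierInv_fourier_eq f.integrable (𝓕 f).integrable]
  rw [h, eLpNorm_one_eq_lintegral_enorm]
  refine (enorm_integral_le_lintegral_enorm _).trans (lintegral_mono fun ξ => le_of_eq ?_)
  simp [← ofReal_norm]

/-- Bernstein's inequality from `L^r` to `L²`, for a function whose Fourier transform vanishes
outside `S`. -/
theorem SchwartzMap.eLpNorm_two_le_of_support_fourier_subset (f : SchwartzMap V H) {S : Set V}
    (hS : Function.support (𝓕 ⇑f) ⊆ S) {r : ℝ} (hr0 : 0 < r) (hr2 : r ≤ 2) :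
    eLpNorm (⇑f) 2 volume ≤
      volume S ^ (1 / r - 1 / 2) * eLpNorm (⇑f) (ENNReal.ofReal r) volume := by
  set N := eLpNorm (⇑f) 2 volume with hN
  set X := eLpNorm (⇑f) (ENNReal.ofReal r) volume
  have hNtop : N ≠ ⊤ := (f.memLp 2 volume).eLpNorm_ne_top
  rcases eq_or_ne N 0 with hN0 | hN0
  · simp [hN0]
  have hbound : eLpNorm (𝓕 ⇑f) 1 volume ≤ N * volume S ^ (1 / 2 : ℝ) := by
    have h := eLpNorm_le_eLpNorm_mul_rpow_measure_univ (μ := volume.restrict S)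
      (p := 1) (q := 2) (f := 𝓕 ⇑f) one_le_two
      ((𝓕 f).continuous.aestronglyMeasurable)
    rw [eLpNorm_restrict_eq_of_support_subset hS, eLpNorm_restrict_eq_of_support_subset hS,
      f.eLpNorm_two_fourier, Measure.restrict_apply_univ] at h
    norm_num at h ⊢
    exact h
  have hinterp := eLpNorm_two_sq_le_of_enorm_le (μ := volume) (f := ⇑f)
    f.continuous.aestronglyMeasurable
    (fun x => (f.enorm_apply_le_eLpNorm_fourier x).trans hbound) hr0 hr2
  have h2r : 0 ≤ 2 - r := by linarith
  have hpow : N ^ r ≤ (volume S ^ (1 / r - 1 / 2) * X) ^ r := by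
    have hsplit : N ^ (2 : ℝ) = N ^ (2 - r) * N ^ r := by
      rw [← ENNReal.rpow_add_of_nonneg _ _ h2r hr0.le, sub_add_cancel]
    rw [← hN, hsplit, ENNReal.mul_rpow_of_nonneg _ _ h2r, mul_assoc] at hinterp
    have h := (ENNReal.mul_le_mul_iff_right (by simp [hN0, hNtop]) (by simp [hN0, hNtop])).1 hinterp
    rw [ENNReal.mul_rpow_of_nonneg _ _ hr0.le, ← ENNReal.rpow_mul]
    rw [← ENNReal.rpow_mul] at h
    convert h using 3
    field_simp
  exact (ENNReal.rpow_le_rpow_iff hr0).1 hpow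

end Bernstein

theorem Real.rpow_le_mul_exp {a p v : ℝ} (ha : 0 < a) (hp : 0 ≤ p) (hv : 0 ≤ v) :
    v ^ p ≤ (p / a + 1) ^ p * Real.exp (a * v) := by
  have hk : 0 < p / a + 1 := by positivity
  have h1 : v ≤ (p / a + 1) * Real.exp (v / (p / a + 1)) := by
    have := Real.add_one_le_exp (v / (p / a + 1))
    calc v = (p / a + 1) * (v / (p / a + 1)) := by field_simp
      _ ≤ _ := by gcongr; linarith
  calc v ^ p ≤ ((p / a + 1) * Real.exp (v / (p / a + 1))) ^ p := by gcongr
    _ = (p / a + 1) ^ p * Real.exp (v / (p / a + 1) * p) := by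
        rw [Real.mul_rpow hk.le (Real.exp_pos _).le, ← Real.exp_mul]
    _ ≤ (p / a + 1) ^ p * Real.exp (a * v) := by
        refine mul_le_mul_of_nonneg_left (Real.exp_le_exp.2 ?_) (by positivity)
        rw [div_mul_eq_mul_div, div_le_iff₀ hk]
        have : a * v * (p / a + 1) = v * p + a * v := by field_simp
        rw [this]
        have : 0 ≤ a * v := by positivity
        linarith

/-- Decay in time of the kernel `exp (-a t y ^ (-σ))`, uniformly in `y ≥ R₀`, at the price of
`y ^ m`. -/
theorem exists_exp_neg_mul_rpow_le {a σ R₀ m : ℝ} (ha : 0 < a) (hσ : 0 < σ) (hR₀ : 0 < R₀)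
    (hm : 0 ≤ m) :
    ∃ D : ℝ, 0 < D ∧ ∀ y t : ℝ, R₀ ≤ y → 0 ≤ t →
      Real.exp (-(a * t) * y ^ (-σ)) ≤ D * y ^ m * (1 + t) ^ (-m / σ) := by
  have hp : 0 ≤ m / σ := by positivity
  refine ⟨(m / σ / a + 1) ^ (m / σ) * Real.exp (a * R₀ ^ (-σ)), by positivity,
    fun y t hy ht => ?_⟩
  have hy0 : 0 < y := hR₀.trans_le hy
  have ht1 : 0 < 1 + t := by linarith
  have hs : 0 < y ^ (-σ) := by positivity
  have hsS : y ^ (-σ) ≤ R₀ ^ (-σ) := Real.rpow_le_rpow_of_nonpos hR₀ hy (by linarith)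
  have hv : 0 ≤ y ^ (-σ) * (1 + t) := by positivity
  have key := Real.rpow_le_mul_exp ha hp hv
  rw [Real.mul_rpow hs.le ht1.le, ← Real.rpow_mul hy0.le] at key
  have hexp : -σ * (m / σ) = -m := by field_simp
  rw [hexp, Real.rpow_neg hy0.le] at key
  have hfac : 0 < y ^ m := by positivity
  have hfac' : 0 < (1 + t) ^ (m / σ) := by positivity
  have hone : 1 ≤ (m / σ / a + 1) ^ (m / σ) * Real.exp (a * (y ^ (-σ) * (1 + t))) * y ^ m *
      (1 + t) ^ (-m / σ) := by
    rw [neg_div, Real.rpow_neg ht1.le]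
    calc (1 : ℝ) = ((y ^ m)⁻¹ * (1 + t) ^ (m / σ)) * y ^ m * ((1 + t) ^ (m / σ))⁻¹ := by
          field_simp
      _ ≤ _ := by gcongr
  calc Real.exp (-(a * t) * y ^ (-σ))
      ≤ Real.exp (-(a * t) * y ^ (-σ)) * ((m / σ / a + 1) ^ (m / σ) *
          Real.exp (a * (y ^ (-σ) * (1 + t))) * y ^ m * (1 + t) ^ (-m / σ)) :=
        le_mul_of_one_le_right (Real.exp_pos _).le hone
    _ = (m / σ / a + 1) ^ (m / σ) * Real.exp (a * y ^ (-σ)) * y ^ m * (1 + t) ^ (-m / σ) := by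
        have : Real.exp (a * y ^ (-σ)) =
            Real.exp (-(a * t) * y ^ (-σ)) * Real.exp (a * (y ^ (-σ) * (1 + t))) := by
          rw [← Real.exp_add]; ring_nf
        rw [this]; ring
    _ ≤ _ := by gcongr

/-- The single-block high-frequency estimate (R-E22) in the proof of Theorem 1.1. -/
theorem single_block_high_freq_estimate
    (n : ℕ) (hn : 1 ≤ n) (σ c R₀ : ℝ) (hσ : 0 < σ) (hc : 0 < c) (hR₀ : 0 < R₀)
    (r : ℝ) (hr1 : 1 ≤ r) (hr2 : r ≤ 2)
    (ℓ : ℝ) (hℓ : (n : ℝ) * (1 / r - 1 / 2) < ℓ ∨ (r = 2 ∧ 0 ≤ ℓ)) :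
    ∃ C : ℝ≥0, 0 < C ∧
      ∀ q : ℤ, R₀ ≤ (2 : ℝ) ^ q →
        ∀ f : SchwartzMap (EuclideanSpace ℝ (Fin n)) ℂ,
          Function.support (𝓕 ⇑f) ⊆
            {ξ : EuclideanSpace ℝ (Fin n) | (3 / 4 : ℝ) * 2 ^ q ≤ ‖ξ‖ ∧ ‖ξ‖ ≤ (8 / 3 : ℝ) * 2 ^ q} →
          ∀ t : ℝ, 0 ≤ t →
            eLpNorm (fun ξ : EuclideanSpace ℝ (Fin n) =>
                Real.exp (-(c * t) * ‖ξ‖ ^ (-σ)) • 𝓕 (⇑f) ξ) 2 volume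
              ≤ C * (2 : ℝ≥0∞) ^ ((q : ℝ) * ℓ) *
                  ENNReal.ofReal ((1 + t) ^ (-ℓ / σ + (n : ℝ) / σ * (1 / r - 1 / 2))) *
                  eLpNorm (⇑f) (ENNReal.ofReal r) volume := by
  set a := 1 / r - 1 / 2 with ha_def
  have hr0 : 0 < r := by linarith
  have ha : 0 ≤ a := sub_nonneg.2 (one_div_le_one_div_of_le hr0 hr2)
  have hm : 0 ≤ ℓ - n * a := by
    rcases hℓ with h | ⟨rfl, h⟩
    · linarith
    · simpa [ha_def] using h
  obtain ⟨D, hD, hdecay⟩ := exists_exp_neg_mul_rpow_le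
    (a := c * (8 / 3 : ℝ) ^ (-σ)) (by positivity) hσ hR₀ hm
  set K := volume.real (Metric.closedBall (0 : EuclideanSpace ℝ (Fin n)) (8 / 3))
  have hK : 0 < K :=
    ENNReal.toReal_pos (Metric.measure_closedBall_pos volume _ (by norm_num)).ne'
      measure_closedBall_lt_top.ne
  have hC : 0 < K ^ a * D := by positivity
  refine ⟨(K ^ a * D).toNNReal, Real.toNNReal_pos.2 hC, fun q hq f hf t ht => ?_⟩
  set y : ℝ := 2 ^ q with hy_def
  have hy : 0 < y := by positivity
  have ht1 : 0 < 1 + t := by linarith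
  set E := Real.exp (-(c * (8 / 3 : ℝ) ^ (-σ) * t) * y ^ (-σ))
  have hE : 0 < E := Real.exp_pos _
  have hmult : eLpNorm (fun ξ : EuclideanSpace ℝ (Fin n) =>
      Real.exp (-(c * t) * ‖ξ‖ ^ (-σ)) • 𝓕 (⇑f) ξ) 2 volume ≤
      ENNReal.ofReal E * eLpNorm (⇑f) 2 volume := by
    rw [← f.eLpNorm_two_fourier]
    refine eLpNorm_le_mul_eLpNorm_of_ae_le_mul (Filter.Eventually.of_forall fun ξ => ?_) 2
    rw [norm_smul, Real.norm_of_nonneg (Real.exp_pos _).le]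
    by_cases h0 : 𝓕 (⇑f) ξ = 0
    · simp [h0]
    obtain ⟨h1, h2⟩ := hf h0
    have hξ : 0 < ‖ξ‖ := lt_of_lt_of_le (by positivity) h1
    have h3 : (8 / 3 : ℝ) ^ (-σ) * y ^ (-σ) ≤ ‖ξ‖ ^ (-σ) := by
      rw [← Real.mul_rpow (by norm_num) hy.le]
      exact Real.rpow_le_rpow_of_nonpos hξ h2 (by linarith)
    refine mul_le_mul_of_nonneg_right (Real.exp_le_exp.2 ?_) (norm_nonneg _)
    have := mul_le_mul_of_nonneg_left h3 (mul_nonneg hc.le ht)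
    linarith
  have hball : Function.support (𝓕 ⇑f) ⊆
      Metric.closedBall (0 : EuclideanSpace ℝ (Fin n)) (y * (8 / 3)) := fun ξ hξ => by
    simpa [mul_comm] using (hf hξ).2
  have hvol : volume (Metric.closedBall (0 : EuclideanSpace ℝ (Fin n)) (y * (8 / 3))) =
      ENNReal.ofReal (y ^ n * K) := by
    rw [Measure.addHaar_closedBall_mul volume _ hy.le (by norm_num), finrank_euclideanSpace_fin,
      ENNReal.ofReal_mul (by positivity), ofReal_measureReal measure_closedBall_lt_top.ne]
  have hbern := f.eLpNorm_two_le_of_support_fourier_subset hball hr0 hr2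
  rw [hvol, ENNReal.ofReal_rpow_of_nonneg (by positivity) ha] at hbern
  have htwo : (2 : ℝ≥0∞) ^ ((q : ℝ) * ℓ) = ENNReal.ofReal (y ^ ℓ) := by
    rw [hy_def, ← Real.rpow_intCast, ← Real.rpow_mul zero_le_two,
      ← ENNReal.ofReal_rpow_of_pos two_pos, ENNReal.ofReal_ofNat]
  have hreal : E * (y ^ n * K) ^ a ≤
      K ^ a * D * y ^ ℓ * (1 + t) ^ (-ℓ / σ + (n : ℝ) / σ * a) := by
    have h := hdecay y t hq ht
    rw [Real.mul_rpow (by positivity) hK.le, ← Real.rpow_natCast, ← Real.rpow_mul hy.le]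
    have hℓsplit : y ^ ℓ = y ^ (ℓ - n * a) * y ^ (n * a) := by
      rw [← Real.rpow_add hy, sub_add_cancel]
    have hexp : -ℓ / σ + (n : ℝ) / σ * a = -(ℓ - n * a) / σ := by ring
    rw [hℓsplit, hexp]
    calc E * (y ^ (n * a) * K ^ a)
        ≤ D * y ^ (ℓ - n * a) * (1 + t) ^ (-(ℓ - n * a) / σ) * (y ^ (n * a) * K ^ a) := by
          gcongr
      _ = _ := by ring
  calc _ ≤ ENNReal.ofReal E * (ENNReal.ofReal ((y ^ n * K) ^ a) *
          eLpNorm (⇑f) (ENNReal.ofReal r) volume) := hmult.trans (by gcongr)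
    _ = ENNReal.ofReal (E * (y ^ n * K) ^ a) * eLpNorm (⇑f) (ENNReal.ofReal r) volume := by
        rw [ENNReal.ofReal_mul hE.le, mul_assoc]
    _ ≤ ENNReal.ofReal (K ^ a * D * y ^ ℓ * (1 + t) ^ (-ℓ / σ + (n : ℝ) / σ * a)) *
          eLpNorm (⇑f) (ENNReal.ofReal r) volume := by gcongr
    _ = _ := by
        rw [htwo, ENNReal.ofReal_mul (by positivity), ENNReal.ofReal_mul hC.le]
        rfl
end
end

section
/- Let η₀(ξ) = |ξ|²/(1+|ξ|²)² for ξ ∈ ℝ³, let c₀ > 0, and let k and ℓ be nonnegative real numbers. Then there exists a constant C > 0 such that for every Schwartz function f on ℝ³ and every t ≥ 0: ( ∫_{ℝ³} |ξ|^{2k} |\hat f(ξ)|² e^{−2 c₀ η₀(ξ) t} dξ )^{1/2} ≤ C [ (1+t)^{−3/4 − k/2} ‖f‖_{L¹(ℝ³)} + (1+t)^{−ℓ/2} ( ∫_{ℝ³} |ξ|^{2(k+ℓ)} |\hat f(ξ)|² dξ )^{1/2} ]. -/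
open MeasureTheory Real
open scoped FourierTransform

noncomputable section

/-- A real power is dominated by one plus the next natural power. -/
lemma rpow_le_one_add_pow_ceil {x p : ℝ} (hx : 0 ≤ x) (hp : 0 ≤ p) :
    x ^ p ≤ 1 + x ^ ⌈p⌉₊ := by
  rcases le_total x 1 with h | h
  · have h1 := Real.rpow_le_one hx h hp
    have h2 : 0 ≤ x ^ ⌈p⌉₊ := by positivity
    linarith
  · have h1 := Real.rpow_le_rpow_of_exponent_le h (Nat.le_ceil p)
    rw [Real.rpow_natCast] at h1
    linarith

lemma exists_rpow_mul_exp_neg_le {a p : ℝ} (ha : 0 < a) (hp : 0 ≤ p) :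
    ∃ C : ℝ, 0 < C ∧ ∀ y : ℝ, 0 ≤ y → y ^ p * Real.exp (-a * y) ≤ C := by
  refine ⟨1 + (⌈p⌉₊.factorial : ℝ) / a ^ ⌈p⌉₊, by positivity, fun y hy => ?_⟩
  have h1 := rpow_le_one_add_pow_ceil hy hp
  have h2 := Real.pow_div_factorial_le_exp (a * y) (by positivity) ⌈p⌉₊
  have h3 : y ^ ⌈p⌉₊ ≤ (⌈p⌉₊.factorial : ℝ) / a ^ ⌈p⌉₊ * Real.exp (a * y) := by
    rw [mul_pow, div_le_iff₀ (by positivity)] at h2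
    rw [div_mul_eq_mul_div, le_div_iff₀ (by positivity)]
    linarith
  have h4 : 1 ≤ Real.exp (a * y) := Real.one_le_exp (by positivity)
  rw [neg_mul, Real.exp_neg, ← div_eq_mul_inv, div_le_iff₀ (Real.exp_pos _)]
  linarith

/-- The dissipative factor splits into a heat-type low-frequency factor and a high-frequency
factor with polynomial decay in time and loss of `ℓ` derivatives. -/
lemma exists_exp_regularity_loss_le {c ℓ : ℝ} (hc : 0 < c) (hℓ : 0 ≤ ℓ) :
    ∃ B : ℝ, 0 < B ∧ ∀ r t : ℝ, 0 ≤ r → 0 ≤ t →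
      Real.exp (-2 * c * (r ^ 2 / (1 + r ^ 2) ^ 2) * t) ≤
        Real.exp (c / 2) * Real.exp (-(c / 2) * ((1 + t) * r ^ 2)) +
          B * ((1 + t) ^ (-ℓ) * r ^ (2 * ℓ)) := by
  obtain ⟨C, hC, hy⟩ := exists_rpow_mul_exp_neg_le (half_pos hc) hℓ
  refine ⟨Real.exp (c / 2) * C, by positivity, fun r t hr ht => ?_⟩
  rcases le_total r 1 with h | h
  · refine le_add_of_le_of_nonneg ?_ (by positivity)
    rw [← Real.exp_add, Real.exp_le_exp]
    have hr2 : r ^ 2 ≤ 1 := pow_le_one₀ hr h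
    have h1 : r ^ 2 / 4 ≤ r ^ 2 / (1 + r ^ 2) ^ 2 := by
      gcongr
      nlinarith [sq_nonneg r]
    have h2 := mul_le_mul_of_nonneg_left h1 (mul_nonneg hc.le ht)
    have h3 := mul_le_mul_of_nonneg_left hr2 hc.le
    linarith
  · refine le_add_of_nonneg_of_le (by positivity) ?_
    have hr0 : 0 < r := by linarith
    have hr2 : 1 ≤ r ^ 2 := one_le_pow₀ h
    have h1 : 1 / (4 * r ^ 2) ≤ r ^ 2 / (1 + r ^ 2) ^ 2 := by
      rw [div_le_div_iff₀ (by positivity) (by positivity)]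
      nlinarith
    have h2 := mul_le_mul_of_nonneg_left h1 (mul_nonneg hc.le ht)
    have h3 : (1 + t) / r ^ 2 ≤ 1 + 4 * t * (1 / (4 * r ^ 2)) := by
      rw [add_div]
      refine add_le_add ((div_le_one (by positivity)).2 hr2) (le_of_eq ?_)
      field_simp
    have h4 := mul_le_mul_of_nonneg_left h3 hc.le
    have h5 : Real.exp (-2 * c * (r ^ 2 / (1 + r ^ 2) ^ 2) * t) ≤
        Real.exp (c / 2) * Real.exp (-(c / 2) * ((1 + t) / r ^ 2)) := by
      rw [← Real.exp_add, Real.exp_le_exp]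
      linarith
    refine h5.trans ?_
    rw [mul_assoc]
    gcongr
    have h6 := hy ((1 + t) / r ^ 2) (by positivity)
    rw [Real.div_rpow (by positivity) (by positivity), ← Real.rpow_natCast r 2,
      ← Real.rpow_mul hr, Nat.cast_ofNat, div_mul_eq_mul_div, div_le_iff₀ (by positivity)] at h6
    rw [Real.rpow_neg (by positivity), ← Real.rpow_natCast r 2, Nat.cast_ofNat]
    rw [show C * (((1 + t) ^ ℓ)⁻¹ * r ^ (2 * ℓ)) = C * r ^ (2 * ℓ) / (1 + t) ^ ℓ by
      rw [div_eq_mul_inv]; ring, le_div_iff₀ (by positivity)]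
    linarith

lemma integrable_norm_rpow_mul_exp_neg_mul_sq {k b : ℝ} (hk : 0 ≤ k) (hb : 0 < b) :
    Integrable fun ξ : EuclideanSpace ℝ (Fin 3) =>
      ‖ξ‖ ^ (2 * k) * Real.exp (-b * ‖ξ‖ ^ 2) := by
  rw [integrable_fun_norm_addHaar volume (f := fun r : ℝ => r ^ (2 * k) * Real.exp (-b * r ^ 2))]
  refine (integrableOn_rpow_mul_exp_neg_mul_sq hb
    (show (-1 : ℝ) < 2 + 2 * k by linarith)).congr_fun (fun r hr => ?_) measurableSet_Ioi
  have hr : 0 < r := hr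
  simp [Real.rpow_add hr, mul_assoc]

lemma integral_norm_rpow_mul_exp_neg_mul_sq_scale (k b : ℝ) {s : ℝ} (hs : 0 < s) :
    ∫ ξ : EuclideanSpace ℝ (Fin 3), ‖ξ‖ ^ (2 * k) * Real.exp (-b * (s * ‖ξ‖ ^ 2)) =
      s ^ (-(3 : ℝ) / 2 - k) *
        ∫ ξ : EuclideanSpace ℝ (Fin 3), ‖ξ‖ ^ (2 * k) * Real.exp (-b * ‖ξ‖ ^ 2) := by
  have h := Measure.integral_comp_smul (volume : Measure (EuclideanSpace ℝ (Fin 3)))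
    (fun ξ => ‖ξ‖ ^ (2 * k) * Real.exp (-b * ‖ξ‖ ^ 2)) (√s)
  have hpow : (√s) ^ (2 * k) = s ^ k := by
    rw [Real.rpow_mul (by positivity), Real.rpow_two, Real.sq_sqrt hs.le]
  have hcube : |((√s) ^ 3)⁻¹| = s ^ (-(3 : ℝ) / 2) := by
    rw [abs_of_pos (by positivity), Real.sqrt_eq_rpow, ← Real.rpow_natCast,
      ← Real.rpow_mul hs.le, ← Real.rpow_neg hs.le]
    norm_num
  simp only [norm_smul, Real.norm_eq_abs, abs_of_nonneg (Real.sqrt_nonneg s), mul_pow,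
    Real.sq_sqrt hs.le, Real.mul_rpow (Real.sqrt_nonneg s) (norm_nonneg _), hpow, mul_assoc,
    integral_const_mul, finrank_euclideanSpace_fin, hcube, smul_eq_mul] at h
  rw [Real.rpow_sub hs, div_mul_eq_mul_div, eq_div_iff (by positivity), mul_comm, h]

lemma norm_fourier_le_integral_norm (f : SchwartzMap (EuclideanSpace ℝ (Fin 3)) ℂ)
    (ξ : EuclideanSpace ℝ (Fin 3)) : ‖𝓕 (⇑f) ξ‖ ≤ ∫ x, ‖f x‖ :=
  VectorFourier.norm_fourierIntegral_le_integral_norm _ _ _ _ _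

lemma integrable_norm_rpow_mul_norm_fourier_sq {p : ℝ} (hp : 0 ≤ p)
    (f : SchwartzMap (EuclideanSpace ℝ (Fin 3)) ℂ) :
    Integrable fun ξ : EuclideanSpace ℝ (Fin 3) => ‖ξ‖ ^ p * ‖𝓕 (⇑f) ξ‖ ^ (2 : ℝ) := by
  have h0 := (𝓕 f).integrable_pow_mul volume 0
  have h1 := (𝓕 f).integrable_pow_mul volume ⌈p⌉₊
  rw [SchwartzMap.fourier_coe] at h0 h1
  have hcont : Continuous (𝓕 (⇑f)) := by
    rw [← SchwartzMap.fourier_coe]; exact (𝓕 f).continuous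
  refine ((h0.add h1).const_mul (∫ x, ‖f x‖)).mono' ?_ (ae_of_all _ fun ξ => ?_)
  · refine Continuous.aestronglyMeasurable ?_
    exact (continuous_norm.rpow_const fun _ => Or.inr hp).mul
      (hcont.norm.rpow_const fun _ => Or.inr (by norm_num))
  · rw [Real.norm_of_nonneg (by positivity), Real.rpow_two]
    have hM := norm_fourier_le_integral_norm f ξ
    have hr := rpow_le_one_add_pow_ceil (norm_nonneg ξ) hp
    calc ‖ξ‖ ^ p * ‖𝓕 (⇑f) ξ‖ ^ 2 = ‖ξ‖ ^ p * (‖𝓕 (⇑f) ξ‖ * ‖𝓕 (⇑f) ξ‖) := by rw [sq]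
      _ ≤ (1 + ‖ξ‖ ^ ⌈p⌉₊) * ((∫ x, ‖f x‖) * ‖𝓕 (⇑f) ξ‖) := by gcongr
      _ = _ := by simp only [Pi.add_apply, pow_zero]; ring

/-- Fourier-side form of the `L¹`-`L²` decay estimate of regularity-loss type
(estimate (R-E12)) for the dissipative rate `η₀(ξ) = |ξ|²/(1+|ξ|²)²`. -/
theorem regularity_loss_decay_estimate
    (c₀ : ℝ) (hc₀ : 0 < c₀) (k ℓ : ℝ) (hk : 0 ≤ k) (hℓ : 0 ≤ ℓ) :
    ∃ C : ℝ, 0 < C ∧ ∀ f : SchwartzMap (EuclideanSpace ℝ (Fin 3)) ℂ, ∀ t : ℝ, 0 ≤ t →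
      (∫ ξ : EuclideanSpace ℝ (Fin 3),
          ‖ξ‖ ^ (2 * k) * ‖𝓕 (⇑f) ξ‖ ^ (2 : ℝ) *
            Real.exp (-2 * c₀ * (‖ξ‖ ^ 2 / (1 + ‖ξ‖ ^ 2) ^ 2) * t)) ^ (1 / (2 : ℝ))
        ≤ C * ((1 + t) ^ (-(3 : ℝ) / 4 - k / 2) *
                (∫ x : EuclideanSpace ℝ (Fin 3), ‖f x‖)
             + (1 + t) ^ (-ℓ / 2) *
                (∫ ξ : EuclideanSpace ℝ (Fin 3),
                  ‖ξ‖ ^ (2 * (k + ℓ)) * ‖𝓕 (⇑f) ξ‖ ^ (2 : ℝ)) ^ (1 / (2 : ℝ))) := by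
  obtain ⟨B, hB, hexp⟩ := exists_exp_regularity_loss_le hc₀ hℓ
  set K : ℝ := ∫ ξ : EuclideanSpace ℝ (Fin 3), ‖ξ‖ ^ (2 * k) * Real.exp (-(c₀ / 2) * ‖ξ‖ ^ 2)
  have hK : 0 ≤ K := integral_nonneg fun ξ => by positivity
  set D : ℝ := Real.exp (c₀ / 2) * K + B with hD
  have hDpos : 0 < D := by positivity
  refine ⟨√D, Real.sqrt_pos.2 hDpos, fun f t ht => ?_⟩
  have hs : 0 < 1 + t := by linarith
  set M : ℝ := ∫ x, ‖f x‖
  have hM : 0 ≤ M := integral_nonneg fun x => norm_nonneg _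
  set J : ℝ := ∫ ξ : EuclideanSpace ℝ (Fin 3), ‖ξ‖ ^ (2 * (k + ℓ)) * ‖𝓕 (⇑f) ξ‖ ^ (2 : ℝ)
  have hJ : 0 ≤ J := integral_nonneg fun ξ => by positivity
  have hlow : Integrable fun ξ : EuclideanSpace ℝ (Fin 3) =>
      ‖ξ‖ ^ (2 * k) * Real.exp (-(c₀ / 2) * ((1 + t) * ‖ξ‖ ^ 2)) := by
    simpa only [neg_mul, mul_assoc] using
      integrable_norm_rpow_mul_exp_neg_mul_sq hk (mul_pos (half_pos hc₀) hs)
  have hhigh := integrable_norm_rpow_mul_norm_fourier_sq (p := 2 * (k + ℓ)) (by positivity) f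
  have key : (∫ ξ : EuclideanSpace ℝ (Fin 3), ‖ξ‖ ^ (2 * k) * ‖𝓕 (⇑f) ξ‖ ^ (2 : ℝ) *
      Real.exp (-2 * c₀ * (‖ξ‖ ^ 2 / (1 + ‖ξ‖ ^ 2) ^ 2) * t)) ≤
      Real.exp (c₀ / 2) * M ^ 2 * ((1 + t) ^ (-(3 : ℝ) / 2 - k) * K) +
        B * (1 + t) ^ (-ℓ) * J := by
    rw [← integral_norm_rpow_mul_exp_neg_mul_sq_scale k (c₀ / 2) hs, ← integral_const_mul,
      ← integral_const_mul, ← integral_add (hlow.const_mul _) (hhigh.const_mul _)]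
    refine integral_mono_of_nonneg (ae_of_all _ fun ξ => by positivity)
      ((hlow.const_mul _).add (hhigh.const_mul _)) (ae_of_all _ fun ξ => ?_)
    have hF : ‖𝓕 (⇑f) ξ‖ ^ (2 : ℝ) ≤ M ^ 2 := by
      rw [Real.rpow_two]
      gcongr
      exact norm_fourier_le_integral_norm f ξ
    have hadd : ‖ξ‖ ^ (2 * (k + ℓ)) = ‖ξ‖ ^ (2 * k) * ‖ξ‖ ^ (2 * ℓ) := by
      rw [mul_add, Real.rpow_add_of_nonneg (norm_nonneg _) (by positivity) (by positivity)]
    calc ‖ξ‖ ^ (2 * k) * ‖𝓕 (⇑f) ξ‖ ^ (2 : ℝ) *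
          Real.exp (-2 * c₀ * (‖ξ‖ ^ 2 / (1 + ‖ξ‖ ^ 2) ^ 2) * t)
        ≤ ‖ξ‖ ^ (2 * k) * ‖𝓕 (⇑f) ξ‖ ^ (2 : ℝ) *
          (Real.exp (c₀ / 2) * Real.exp (-(c₀ / 2) * ((1 + t) * ‖ξ‖ ^ 2)) +
            B * ((1 + t) ^ (-ℓ) * ‖ξ‖ ^ (2 * ℓ))) := by
          gcongr
          exact hexp _ _ (norm_nonneg ξ) ht
      _ = ‖𝓕 (⇑f) ξ‖ ^ (2 : ℝ) * (Real.exp (c₀ / 2) *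
            (‖ξ‖ ^ (2 * k) * Real.exp (-(c₀ / 2) * ((1 + t) * ‖ξ‖ ^ 2)))) +
          B * (1 + t) ^ (-ℓ) * (‖ξ‖ ^ (2 * (k + ℓ)) * ‖𝓕 (⇑f) ξ‖ ^ (2 : ℝ)) := by
          rw [hadd]; ring
      _ ≤ M ^ 2 * (Real.exp (c₀ / 2) *
            (‖ξ‖ ^ (2 * k) * Real.exp (-(c₀ / 2) * ((1 + t) * ‖ξ‖ ^ 2)))) +
          B * (1 + t) ^ (-ℓ) * (‖ξ‖ ^ (2 * (k + ℓ)) * ‖𝓕 (⇑f) ξ‖ ^ (2 : ℝ)) := by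
          gcongr
      _ = _ := by ring
  have hX : (1 + t) ^ (-(3 : ℝ) / 2 - k) = ((1 + t) ^ (-(3 : ℝ) / 4 - k / 2)) ^ 2 := by
    rw [← Real.rpow_mul_natCast hs.le]
    congr 1
    push_cast
    ring
  have hY : (1 + t) ^ (-ℓ) = ((1 + t) ^ (-ℓ / 2)) ^ 2 := by
    rw [← Real.rpow_mul_natCast hs.le]
    congr 1
    push_cast
    ring
  rw [← Real.sqrt_eq_rpow, ← Real.sqrt_eq_rpow]
  refine Real.sqrt_le_iff.2 ⟨by positivity, key.trans ?_⟩
  rw [hX, hY, mul_pow, Real.sq_sqrt hDpos.le]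
  set X : ℝ := (1 + t) ^ (-(3 : ℝ) / 4 - k / 2)
  set Y : ℝ := (1 + t) ^ (-ℓ / 2)
  have hX0 : 0 ≤ X := by positivity
  have hY0 : 0 ≤ Y := by positivity
  calc Real.exp (c₀ / 2) * M ^ 2 * (X ^ 2 * K) + B * Y ^ 2 * J
      = Real.exp (c₀ / 2) * K * (X * M) ^ 2 + B * (Y * √J) ^ 2 := by
        rw [mul_pow Y, Real.sq_sqrt hJ]; ring
    _ ≤ D * (X * M) ^ 2 + D * (Y * √J) ^ 2 := by
        have h1 : Real.exp (c₀ / 2) * K ≤ D := by linarith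
        have h2 : B ≤ D := le_add_of_nonneg_left (by positivity)
        gcongr
    _ ≤ D * (X * M + Y * √J) ^ 2 := by
        rw [← mul_add]
        gcongr
        have : 0 ≤ (X * M) * (Y * √J) := by positivity
        nlinarith
end
end
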